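/- In every Emerson-Lei game with k events, if the system player has a winning strategy from a node v, then the system player has a finite-memory winning strategy from v using at most k! memory values, i.e. a finite-memory strategy (M, m_0, μ, c) with |M| ≤ k! whose induced strategy wins v for the system player. -/

import Mathlib

/-- A game arena: a directed graph whose nodes are partitioned into system
nodes (`sys v` holds) and environment nodes, and in which every node has at
least one successor. -/
structure Arena (V : Type) where
  E : V → V → Prop
  sys : V → Prop
  succ_nonempty : ∀ v, ∃ w, E v w

/-- A play is an infinite path in the arena. -/
def Arena.IsPlay {V : Type} (A : Arena V) (π : ℕ → V) : Prop :=
  ∀ n, A.E (π n) (π (n + 1))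

/-- A strategy assigns to every history `h = v₀...v_{n-1}` and current node
`v_n` a next node. -/
def Strategy (V : Type) : Type := List V → V → V

/-- A system strategy is valid if it always chooses successors at system
nodes. -/
def Arena.ValidSysStrat {V : Type} (A : Arena V) (σ : Strategy V) : Prop :=
  ∀ (h : List V) (v : V), A.sys v → A.E v (σ h v)

/-- An environment strategy is valid if it always chooses successors at
environment nodes. -/
def Arena.ValidEnvStrat {V : Type} (A : Arena V) (σ : Strategy V) : Prop :=
  ∀ (h : List V) (v : V), ¬ A.sys v → A.E v (σ h v)

/-- A play `π` is compatible with a system strategy `σ` if at every system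
node the play follows `σ`. -/
def Arena.SysCompatible {V : Type} (A : Arena V) (σ : Strategy V)
    (π : ℕ → V) : Prop :=
  ∀ n, A.sys (π n) → π (n + 1) = σ ((List.range n).map π) (π n)

/-- A play `π` is compatible with an environment strategy `σ` if at every
environment node the play follows `σ`. -/
def Arena.EnvCompatible {V : Type} (A : Arena V) (σ : Strategy V)
    (π : ℕ → V) : Prop :=
  ∀ n, ¬ A.sys (π n) → π (n + 1) = σ ((List.range n).map π) (π n)

/-- The system player wins node `v` for the objective `O` if it has a valid
strategy such that all compatible plays starting at `v` are in `O`. -/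
def Arena.SysWins {V : Type} (A : Arena V) (O : (ℕ → V) → Prop) (v : V) :
    Prop :=
  ∃ σ : Strategy V, A.ValidSysStrat σ ∧
    ∀ π : ℕ → V, A.IsPlay π → π 0 = v → A.SysCompatible σ π → O π

/-- The environment player wins node `v` for the objective `O` if it has a
valid strategy such that all compatible plays starting at `v` are not in
`O`. -/
def Arena.EnvWins {V : Type} (A : Arena V) (O : (ℕ → V) → Prop) (v : V) :
    Prop :=
  ∃ σ : Strategy V, A.ValidEnvStrat σ ∧
    ∀ π : ℕ → V, A.IsPlay π → π 0 = v → A.EnvCompatible σ π → ¬ O π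


/-- Emerson-Lei formulas over a set `Γ` of events: positive Boolean formulas
over atoms `GF a` and `FG a`. -/
inductive ELForm (Γ : Type) where
  | tt : ELForm Γ
  | ff : ELForm Γ
  | gf : Γ → ELForm Γ
  | fg : Γ → ELForm Γ
  | and : ELForm Γ → ELForm Γ → ELForm Γ
  | or : ELForm Γ → ELForm Γ → ELForm Γ

/-- Satisfaction of an Emerson-Lei formula on an infinite sequence of sets of
events. -/
def ELForm.sat {Γ : Type} (π : ℕ → Finset Γ) : ELForm Γ → Prop
  | .tt => True
  | .ff => False
  | .gf a => ∀ i, ∃ j > i, a ∈ π j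
  | .fg a => ∃ i, ∀ j > i, a ∈ π j
  | .and φ ψ => φ.sat π ∧ ψ.sat π
  | .or φ ψ => φ.sat π ∨ ψ.sat π

/-- The strategy induced by a finite-memory strategy `(M, m₀, μ, c)`:
on a history `v₀...v_{n-1}` with current node `v_n` it plays `c v_n m_{n+1}`,
where `m₀` is the initial memory value and `m_{i+1} = μ m_i v_i`. -/
def inducedStrategy {V M : Type} (m₀ : M) (μ : M → V → M) (c : V → M → V) :
    Strategy V :=
  fun h v => c v (List.foldl μ m₀ (h ++ [v]))

namespace MullerGame

open Filter

section Basic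

variable {V M : Type} (E : V → V → Prop) (sys : V → Prop)

open Classical in
/-- Turn a proposed move `w` from `u` into a legal move inside the subarena `U`, whenever there
is one. -/
noncomputable def legalize (U : Finset V) (u w : V) : V :=
  if E u w ∧ w ∈ U then w else if h : ∃ w', E u w' ∧ w' ∈ U then h.choose else w

/-- Every node of `U` has a successor inside `U`. -/
def Total (U : Finset V) : Prop := ∀ u ∈ U, ∃ w, E u w ∧ w ∈ U

/-- One step of the play on the subarena `U` in which the system player follows the strategy
`(μ, c)` with (possibly infinite) memory `M`. -/
structure Step (U : Finset V) (μ : M → V → M) (c : V → M → V) (s t : V × M) : Prop where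
  src : s.1 ∈ U
  tgt : t.1 ∈ U
  edge : E s.1 t.1
  mem : t.2 = μ s.2 s.1
  move : sys s.1 → t.1 = legalize E U s.1 (c s.1 t.2)

open Classical in
/-- The nodes visited infinitely often. -/
noncomputable def infSet [Fintype V] (π : ℕ → V) : Finset V :=
  {v | ∃ᶠ n in atTop, π n = v}

/-- The strategy `(μ, c)` wins from the state `s` in the subarena `U`, for the Muller
objective `F`. -/
def Wins [Fintype V] (F : Finset V → Prop) (U : Finset V) (μ : M → V → M) (c : V → M → V)
    (s : V × M) : Prop :=
  ∀ f : ℕ → V × M, f 0 = s → (∀ n, Step E sys U μ c (f n) (f (n + 1))) →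
    F (infSet fun n => (f n).1)

/-- Some strategy with arbitrary memory wins from `u` in `U`. -/
def SysWin [Fintype V] (F : Finset V → Prop) (U : Finset V) (u : V) : Prop :=
  ∃ (M : Type) (μ : M → V → M) (c : V → M → V) (m : M), Wins E sys F U μ c (u, m)

/-- Some strategy with memory `M` wins from all nodes of `U` and all initial memory values. -/
def UniformWin [Fintype V] (F : Finset V → Prop) (U : Finset V) (M : Type) : Prop :=
  ∃ (μ : M → V → M) (c : V → M → V), ∀ u ∈ U, ∀ m, Wins E sys F U μ c (u, m)

variable {E sys}

theorem legalize_spec {U : Finset V} (hU : Total E U) {u : V} (hu : u ∈ U) (w : V) :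
    E u (legalize E U u w) ∧ legalize E U u w ∈ U := by
  unfold legalize
  split_ifs with h1 h2
  · exact h1
  · exact h2.choose_spec
  · exact absurd (hU u hu) h2

theorem legalize_of_legal {U : Finset V} {u w : V} (h : E u w) (hw : w ∈ U) :
    legalize E U u w = w := if_pos ⟨h, hw⟩

theorem Step.exists {U : Finset V} (hU : Total E U) (μ : M → V → M) (c : V → M → V)
    {s : V × M} (hs : s.1 ∈ U) : ∃ t, Step E sys U μ c s t := by
  by_cases h : sys s.1
  · have := legalize_spec hU hs (c s.1 (μ s.2 s.1))
    exact ⟨(_, μ s.2 s.1), hs, this.2, this.1, rfl, fun _ => rfl⟩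
  · obtain ⟨w, hw, hwU⟩ := hU _ hs
    exact ⟨(w, μ s.2 s.1), hs, hwU, hw, rfl, fun h' => absurd h' h⟩

end Basic

section InfSet

variable {V : Type} [Fintype V]

theorem mem_infSet {π : ℕ → V} {v : V} : v ∈ infSet π ↔ ∃ᶠ n in atTop, π n = v := by
  simp [infSet]

theorem infSet_shift (π : ℕ → V) (k : ℕ) : infSet (fun n => π (n + k)) = infSet π := by
  ext v
  simp only [mem_infSet]
  constructor
  · intro h
    rw [frequently_atTop] at h ⊢
    intro a
    obtain ⟨b, hb, h⟩ := h a
    exact ⟨b + k, by omega, h⟩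
  · intro h
    rw [frequently_atTop] at h ⊢
    intro a
    obtain ⟨b, hb, h⟩ := h (a + k)
    exact ⟨b - k, by omega, by rwa [Nat.sub_add_cancel (by omega)]⟩

theorem infSet_subset {π : ℕ → V} {U : Finset V} (h : ∀ n, π n ∈ U) : infSet π ⊆ U := by
  intro v hv
  obtain ⟨n, rfl⟩ := (mem_infSet.1 hv).exists
  exact h n

theorem exists_mem_infSet {π : ℕ → V} {P : V → Prop} (h : ∃ᶠ n in atTop, P (π n)) :
    ∃ v ∈ infSet π, P v := by
  by_contra hc
  push Not at hc
  apply h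
  have : ∀ᶠ n in atTop, ∀ v, P v → π n ≠ v := by
    rw [eventually_all]
    intro v
    by_cases hv : P v
    · have := mt (hc v) (not_not.2 hv)
      rw [mem_infSet, not_frequently] at this
      exact this.mono fun _ h _ => h
    · exact .of_forall fun _ h => absurd h hv
  exact this.mono fun n hn hp => hn _ hp rfl

end InfSet

section Attractor

variable {V : Type} {E : V → V → Prop}

/-- `A` is the attractor of `T` in `U` for the player owning the nodes in `own`, with rank
function `r`. -/
structure IsAttractor (E : V → V → Prop) (own : V → Prop) (U T A : Finset V) (r : V → ℕ) :
    Prop where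
  target_subset : T ⊆ A
  subset : A ⊆ U
  own_step : ∀ u ∈ A, u ∉ T → own u → ∃ w ∈ A, E u w ∧ r w < r u
  other_step : ∀ u ∈ A, u ∉ T → ¬ own u → ∀ w ∈ U, E u w → w ∈ A ∧ r w < r u
  own_trap : ∀ u ∈ U, u ∉ A → own u → ∀ w ∈ U, E u w → w ∉ A
  other_trap : ∀ u ∈ U, u ∉ A → ¬ own u → ∃ w ∈ U, E u w ∧ w ∉ A

/-- The nodes from which the owner can force a visit to `T` in at most `n` steps. -/
def attractWithin (E : V → V → Prop) (own : V → Prop) (U T : Finset V) : ℕ → V → Prop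
  | 0, u => u ∈ T
  | n + 1, u => attractWithin E own U T n u ∨
      u ∈ U ∧ ((own u ∧ ∃ w ∈ U, E u w ∧ attractWithin E own U T n w) ∨
        (¬ own u ∧ ∀ w ∈ U, E u w → attractWithin E own U T n w))

theorem attractWithin_mono {own : V → Prop} {U T : Finset V} {u : V} :
    Monotone fun n => attractWithin E own U T n u :=
  monotone_nat_of_le_succ fun _ h => Or.inl h

theorem exists_isAttractor (own : V → Prop) {U T : Finset V} (hT : T ⊆ U) :
    ∃ A r, IsAttractor E own U T A r := by
  classical
  let a := attractWithin E own U T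
  let r : V → ℕ := fun u => if h : ∃ n, a n u then Nat.find h else 0
  have hr : ∀ {u n}, a n u → r u ≤ n := by
    intro u n h
    have h' : ∃ n, a n u := ⟨n, h⟩
    simp only [r, dif_pos h']
    exact Nat.find_le h
  have ha : ∀ {u}, (∃ n, a n u) → a (r u) u := by
    intro u h
    simp only [r, dif_pos h]
    exact Nat.find_spec h
  have key : ∀ u, (∃ n, a n u) → u ∉ T → ∃ n, r u = n + 1 ∧
      ((own u ∧ ∃ w ∈ U, E u w ∧ a n w) ∨ (¬ own u ∧ ∀ w ∈ U, E u w → a n w)) := by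
    intro u h hu
    have h1 := ha h
    cases hn : r u with
    | zero => rw [hn] at h1; exact absurd h1 hu
    | succ n =>
      rw [hn] at h1
      refine ⟨n, rfl, ?_⟩
      rcases h1 with h1 | h1
      · have := hr h1
        omega
      · exact h1.2
  refine ⟨{u ∈ U | ∃ n, a n u}, r, ?_, Finset.filter_subset _ _, ?_, ?_, ?_, ?_⟩
  · intro u hu
    exact Finset.mem_filter.2 ⟨hT hu, 0, hu⟩
  · intro u hu huT ho
    obtain ⟨n, hn, h | h⟩ := key u (Finset.mem_filter.1 hu).2 huT
    · obtain ⟨-, w, hw, hE, hw'⟩ := h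
      exact ⟨w, Finset.mem_filter.2 ⟨hw, n, hw'⟩, hE, by have := hr hw'; omega⟩
    · exact absurd ho h.1
  · intro u hu huT ho w hw hE
    obtain ⟨n, hn, h | h⟩ := key u (Finset.mem_filter.1 hu).2 huT
    · exact absurd h.1 ho
    · have hw' := h.2 w hw hE
      exact ⟨Finset.mem_filter.2 ⟨hw, n, hw'⟩, by have := hr hw'; omega⟩
  · intro u hu huA ho w hw hE hwA
    obtain ⟨-, n, hn⟩ := Finset.mem_filter.1 hwA
    exact huA (Finset.mem_filter.2 ⟨hu, n + 1, Or.inr ⟨hu, Or.inl ⟨ho, w, hw, hE, hn⟩⟩⟩)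
  · intro u hu huA ho
    by_contra hc
    push Not at hc
    refine huA (Finset.mem_filter.2 ⟨hu, U.sup r + 1, Or.inr ⟨hu, Or.inr ⟨ho, ?_⟩⟩⟩)
    intro w hw hE
    exact attractWithin_mono (Finset.le_sup hw) (ha (Finset.mem_filter.1 (hc w hw hE)).2)

variable {own : V → Prop} {U T A : Finset V} {r : V → ℕ}

theorem IsAttractor.total_sdiff [DecidableEq V] (h : IsAttractor E own U T A r)
    (hU : Total E U) : Total E (U \ A) := by
  intro u hu
  rw [Finset.mem_sdiff] at hu
  by_cases ho : own u
  · obtain ⟨w, hw, hwU⟩ := hU u hu.1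
    exact ⟨w, hw, Finset.mem_sdiff.2 ⟨hwU, h.own_trap u hu.1 hu.2 ho w hwU hw⟩⟩
  · obtain ⟨w, hwU, hw, hwA⟩ := h.other_trap u hu.1 hu.2 ho
    exact ⟨w, hw, Finset.mem_sdiff.2 ⟨hwU, hwA⟩⟩

open Classical in
/-- The move of the owner that decreases the rank in the attractor. -/
noncomputable def attractMove (E : V → V → Prop) (A : Finset V) (r : V → ℕ) (u : V) : V :=
  if h : ∃ w ∈ A, E u w ∧ r w < r u then h.choose else u

theorem IsAttractor.attractMove_spec (h : IsAttractor E own U T A r) {u : V} (hu : u ∈ A)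
    (huT : u ∉ T) (ho : own u) :
    attractMove E A r u ∈ A ∧ E u (attractMove E A r u) ∧ r (attractMove E A r u) < r u := by
  have h' := h.own_step u hu huT ho
  rw [attractMove, dif_pos h']
  exact h'.choose_spec

/-- A play that uses the attractor strategy outside of the target either leaves the attractor
forever or reaches the target. -/
theorem IsAttractor.not_mem_of_avoid (hA : IsAttractor E own U T A r) {π : ℕ → V}
    {N : ℕ} (hU : ∀ n, π n ∈ U) (hE : ∀ n, E (π n) (π (n + 1)))
    (hmove : ∀ n ≥ N, π n ∈ A → own (π n) → π (n + 1) = attractMove E A r (π n))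
    (hT : ∀ n ≥ N, π n ∉ T) : ∀ n ≥ N, π n ∉ A := by
  have : ∀ e, ∀ n ≥ N, π n ∈ A → r (π n) = e → False := by
    intro e
    induction e using Nat.strong_induction_on with
    | _ e ih =>
      intro n hn hnA he
      have : π (n + 1) ∈ A ∧ r (π (n + 1)) < r (π n) := by
        by_cases hs : own (π n)
        · have := hA.attractMove_spec hnA (hT n hn) hs
          rw [hmove n hn hnA hs]
          exact ⟨this.1, this.2.2⟩
        · exact hA.other_step _ hnA (hT n hn) hs _ (hU _) (hE n)
      exact ih _ (he ▸ this.2) (n + 1) (by omega) this.1 rfl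
  exact fun n hn hnA => this _ n hn hnA rfl

end Attractor

section Wins

variable {V M : Type} [Fintype V] {E : V → V → Prop} {sys : V → Prop} {F : Finset V → Prop}
  {U : Finset V}

theorem Wins.step {μ : M → V → M} {c : V → M → V} {s t : V × M} (h : Wins E sys F U μ c s)
    (hst : Step E sys U μ c s t) : Wins E sys F U μ c t := by
  intro f h0 hf
  have := h (fun n => Nat.casesOn n s f) rfl (fun n => by
    cases n with
    | zero => simpa [h0] using hst
    | succ n => exact hf n)
  rw [← infSet_shift _ 1] at this
  exact this

theorem UniformWin.of_tail {μ : M → V → M} {c : V → M → V}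
    (h : ∀ u ∈ U, ∀ m, Wins E sys F U μ c (u, m)) {f : ℕ → V × M} (N : ℕ)
    (hf : ∀ n ≥ N, Step E sys U μ c (f n) (f (n + 1))) : F (infSet fun n => (f n).1) := by
  have := h (f N).1 (hf N le_rfl).src (f N).2 (fun n => f (n + N)) (by simp) (fun n => by
    have := hf (n + N) (by omega)
    rwa [Nat.add_right_comm n N 1] at this)
  rwa [infSet_shift (fun n => (f n).1)] at this

theorem UniformWin.transfer [Fintype M] [Nonempty M] {M' : Type} [Fintype M']
    (h : UniformWin E sys F U M) (hc : Fintype.card M ≤ Fintype.card M') :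
    UniformWin E sys F U M' := by
  obtain ⟨μ, c, h⟩ := h
  obtain ⟨i⟩ := Function.Embedding.nonempty_of_card_le hc
  have hg := Function.leftInverse_invFun i.injective
  set g := Function.invFun i
  refine ⟨fun m v => i (μ (g m) v), fun v m => c v (g m), fun u hu m f h0 hf => ?_⟩
  refine h u hu (g m) (fun n => ((f n).1, g (f n).2)) (by simp [h0]) fun n => ?_
  obtain ⟨h1, h2, h3, h4, h5⟩ := hf n
  refine ⟨h1, h2, h3, ?_, h5⟩
  simp only [h4]
  exact hg _

theorem SysWin.of_trap {U' : Finset V} (hU : Total E U) (hsub : U' ⊆ U)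
    (htrap : ∀ u ∈ U', sys u → ∀ w ∈ U, E u w → w ∈ U') {u : V}
    (h : SysWin E sys F U u) : SysWin E sys F U' u := by
  obtain ⟨M, μ, c, m, h⟩ := h
  refine ⟨M, μ, fun u m => legalize E U u (c u m), m, fun f h0 hf => h f h0 fun n => ?_⟩
  obtain ⟨h1, h2, h3, h4, h5⟩ := hf n
  refine ⟨hsub h1, hsub h2, h3, h4, fun hs => ?_⟩
  have hl := legalize_spec hU (hsub h1) (c (f n).1 (f (n + 1)).2)
  rw [h5 hs, legalize_of_legal hl.1 (htrap _ h1 hs _ hl.2 hl.1)]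

open Classical in
variable (E sys F U) in
/-- The winning region of the system player in the subarena `U`. -/
noncomputable def winRegion : Finset V := {u ∈ U | SysWin E sys F U u}

theorem mem_winRegion {u : V} : u ∈ winRegion E sys F U ↔ u ∈ U ∧ SysWin E sys F U u := by
  simp [winRegion]

theorem winRegion_subset : winRegion E sys F U ⊆ U := fun _ hu => (mem_winRegion.1 hu).1

theorem winRegion_trap {u w : V} (hu : u ∈ winRegion E sys F U) (hs : ¬ sys u) (hw : w ∈ U)
    (hE : E u w) : w ∈ winRegion E sys F U := by
  obtain ⟨huU, M, μ, c, m, h⟩ := mem_winRegion.1 hu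
  exact mem_winRegion.2 ⟨hw, M, μ, c, μ m u, h.step ⟨huU, hw, hE, rfl, fun h => absurd h hs⟩⟩

theorem total_winRegion (hU : Total E U) : Total E (winRegion E sys F U) := by
  intro u hu
  obtain ⟨huU, M, μ, c, m, h⟩ := mem_winRegion.1 hu
  obtain ⟨t, ht⟩ := Step.exists (sys := sys) hU μ c (s := (u, m)) huU
  exact ⟨t.1, ht.edge, mem_winRegion.2 ⟨ht.tgt, M, μ, c, t.2, h.step ht⟩⟩

theorem sysWin_winRegion (hU : Total E U) {u : V} (hu : u ∈ winRegion E sys F U) :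
    SysWin E sys F (winRegion E sys F U) u := by
  obtain ⟨huU, M, μ, c, m, h⟩ := mem_winRegion.1 hu
  refine ⟨M, μ, fun u m => legalize E U u (c u m), m, fun f h0 hf => ?_⟩
  have key : ∀ n, Wins E sys F U μ c (f n) → Step E sys U μ c (f n) (f (n + 1)) := by
    intro n hn
    obtain ⟨h1, h2, h3, h4, h5⟩ := hf n
    refine ⟨winRegion_subset h1, winRegion_subset h2, h3, h4, fun hs => ?_⟩
    have hl := legalize_spec hU (winRegion_subset h1) (c (f n).1 (f (n + 1)).2)
    rw [h5 hs, legalize_of_legal hl.1]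
    refine mem_winRegion.2 ⟨hl.2, M, μ, c, (f (n + 1)).2, hn.step ?_⟩
    exact ⟨winRegion_subset h1, hl.2, hl.1, h4, fun _ => rfl⟩
  have hw : ∀ n, Wins E sys F U μ c (f n) := by
    intro n
    induction n with
    | zero => rw [h0]; exact h
    | succ n ih => exact ih.step (key n ih)
  exact h f h0 fun n => key n (hw n)

end Wins

section Sequence

variable {S : Type} {R : S → S → Prop}

/-- `P` is reachable along `R` in exactly `n` steps. -/
def ReachIn (R : S → S → Prop) (P : S → Prop) : ℕ → S → Prop
  | 0, s => P s
  | n + 1, s => ∃ t, R s t ∧ ReachIn R P n t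

theorem exists_seq_of_reachIn {I : S → Prop} {P : ℕ → S → Prop}
    (hI : ∀ s t, I s → R s t → I t) (hR : ∀ s, I s → ∃ t, R s t)
    (hP : ∀ s, I s → ∀ k, ∃ n, ReachIn R (P k) n s) {s₀ : S} (h₀ : I s₀) :
    ∃ f : ℕ → S, f 0 = s₀ ∧ (∀ n, R (f n) (f (n + 1))) ∧ ∀ k, ∃ n ≥ k, P k (f n) := by
  classical
  let d : ℕ → S → ℕ := fun k s => if h : ∃ n, ReachIn R (P k) n s then Nat.find h else 0
  have hd : ∀ {k s n}, ReachIn R (P k) n s → d k s ≤ n := by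
    intro k s n h
    have h' : ∃ n, ReachIn R (P k) n s := ⟨n, h⟩
    simp only [d, dif_pos h']
    exact Nat.find_le h
  have hstep : ∀ x : {s // I s} × ℕ, ∃ t : {s // I s}, R x.1 t ∧
      (P x.2 x.1 ∨ d x.2 t < d x.2 x.1) := by
    rintro ⟨⟨s, hs⟩, k⟩
    by_cases hp : P k s
    · obtain ⟨t, ht⟩ := hR s hs
      exact ⟨⟨t, hI s t hs ht⟩, ht, Or.inl hp⟩
    · have h := hP s hs k
      have h1 : ReachIn R (P k) (d k s) s := by
        simp only [d, dif_pos h]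
        exact Nat.find_spec h
      cases hn : d k s with
      | zero => rw [hn] at h1; exact absurd h1 hp
      | succ n =>
        rw [hn] at h1
        obtain ⟨t, ht, h2⟩ := h1
        refine ⟨⟨t, hI s t hs ht⟩, ht, Or.inr ?_⟩
        have := hd h2
        simp only
        omega
  choose next hnext hdec using hstep
  let g : ℕ → {s // I s} × ℕ := fun n =>
    Nat.rec (⟨s₀, h₀⟩, 0) (fun _ x => (next x, if P x.2 x.1 then x.2 + 1 else x.2)) n
  have hg : ∀ n, g (n + 1) = (next (g n), if P (g n).2 (g n).1 then (g n).2 + 1 else (g n).2) :=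
    fun n => rfl
  have hle : ∀ n, (g n).2 ≤ n := by
    intro n
    induction n with
    | zero => exact le_rfl
    | succ n ih => rw [hg]; simp only; split_ifs <;> omega
  have hhit : ∀ e n, d (g n).2 (g n).1 = e → ∃ n', (g n').2 = (g n).2 ∧ P (g n').2 (g n').1 := by
    intro e
    induction e using Nat.strong_induction_on with
    | _ e ih =>
      intro n hn
      by_cases hp : P (g n).2 (g n).1
      · exact ⟨n, rfl, hp⟩
      · have h1 : g (n + 1) = (next (g n), (g n).2) := by rw [hg, if_neg hp]
        have h2 := (hdec (g n)).resolve_left hp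
        obtain ⟨n', h3, h4⟩ := ih _ (hn ▸ h2) (n + 1) (by rw [h1])
        exact ⟨n', by rw [h3, h1], h4⟩
  have hall : ∀ k, ∃ n, (g n).2 = k := by
    intro k
    induction k with
    | zero => exact ⟨0, rfl⟩
    | succ k ih =>
      obtain ⟨n, hn⟩ := ih
      obtain ⟨n', h1, h2⟩ := hhit _ n rfl
      exact ⟨n' + 1, by rw [hg, if_pos h2]; simp only; omega⟩
  refine ⟨fun n => (g n).1, rfl, fun n => ?_, fun k => ?_⟩
  · simp only [hg]
    exact hnext (g n)
  · obtain ⟨n, hn⟩ := hall k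
    obtain ⟨n', h1, h2⟩ := hhit _ n rfl
    have := hle n'
    exact ⟨n', by omega, by rw [h1, hn] at h2; exact h2⟩

end Sequence

section Memory

variable {V M : Type} [Fintype V] [DecidableEq V] {E : V → V → Prop} {sys : V → Prop}
  {F : Finset V → Prop} {U : Finset V}

theorem exists_reachIn_sdiff (hU : Total E U) {Y A : Finset V} {r : V → ℕ}
    (hA : IsAttractor E (fun u => ¬ sys u) U (U \ Y) A r)
    (hlose : ∀ u ∈ U \ A, ¬ SysWin E sys F (U \ A) u)
    {μ : M → V → M} {c : V → M → V} {s : V × M} (hs : s.1 ∈ U) (hw : Wins E sys F U μ c s) :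
    ∃ n, ReachIn (Step E sys U μ c) (fun s => s.1 ∉ Y) n s := by
  have attract : ∀ e (s : V × M), s.1 ∈ A → r s.1 = e →
      ∃ n, ReachIn (Step E sys U μ c) (fun s => s.1 ∉ Y) n s := by
    intro e
    induction e using Nat.strong_induction_on with
    | _ e ih =>
      intro s hsA he
      by_cases hsT : s.1 ∈ U \ Y
      · exact ⟨0, (Finset.mem_sdiff.1 hsT).2⟩
      · have : ∃ t, Step E sys U μ c s t ∧ t.1 ∈ A ∧ r t.1 < r s.1 := by
          by_cases hsys : sys s.1
          · obtain ⟨t, ht⟩ := Step.exists (sys := sys) hU μ c (hA.subset hsA)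
            exact ⟨t, ht, hA.other_step _ hsA hsT (not_not.2 hsys) _ ht.tgt ht.edge⟩
          · obtain ⟨w, hw, hE, hr⟩ := hA.own_step _ hsA hsT hsys
            exact ⟨(w, μ s.2 s.1), ⟨hA.subset hsA, hA.subset hw, hE, rfl,
              fun h => absurd h hsys⟩, hw, hr⟩
        obtain ⟨t, ht, htA, hr⟩ := this
        obtain ⟨n, hn⟩ := ih _ (he ▸ hr) t htA rfl
        exact ⟨n + 1, t, ht, hn⟩
  by_cases hsA : s.1 ∈ A
  · exact attract _ s hsA rfl
  have hs' : s.1 ∈ U \ A := Finset.mem_sdiff.2 ⟨hs, hsA⟩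
  have hnot : ¬ Wins E sys F (U \ A) μ (fun u m => legalize E U u (c u m)) s := fun h =>
    hlose _ hs' ⟨M, μ, _, s.2, h⟩
  simp only [Wins, not_forall] at hnot
  obtain ⟨f, h0, hf, hF⟩ := hnot
  have hsub : U \ A ⊆ U := Finset.sdiff_subset
  have hstep : ∀ n, (sys (f n).1 → legalize E U (f n).1 (c (f n).1 (f (n + 1)).2) ∈ U \ A) →
      Step E sys U μ c (f n) (f (n + 1)) := by
    intro n h
    obtain ⟨h1, h2, h3, h4, h5⟩ := hf n
    refine ⟨hsub h1, hsub h2, h3, h4, fun hsys => ?_⟩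
    rw [h5 hsys, legalize_of_legal (legalize_spec hU (hsub h1) _).1 (h hsys)]
  have hex : ∃ n, ¬ (sys (f n).1 → legalize E U (f n).1 (c (f n).1 (f (n + 1)).2) ∈ U \ A) := by
    by_contra hc
    push Not at hc
    exact hF (hw f h0 fun n => hstep n (hc n))
  classical
  have hfind := Nat.find_spec hex
  have hmin := fun n (h : n < Nat.find hex) => not_not.1 (Nat.find_min hex h)
  set N := Nat.find hex
  have hback : ∀ j ≤ N, ∃ n, ReachIn (Step E sys U μ c) (fun s => s.1 ∉ Y) n (f (N - j)) := by
    intro j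
    induction j with
    | zero =>
      intro _
      push Not at hfind
      obtain ⟨hsys, hout⟩ := hfind
      have hl := legalize_spec hU (hsub (hf N).src) (c (f N).1 (f (N + 1)).2)
      obtain ⟨n, hn⟩ := attract _ (legalize E U (f N).1 (c (f N).1 (f (N + 1)).2), (f (N + 1)).2)
        (by simpa [hl.2] using hout) rfl
      exact ⟨n + 1, (_, _), ⟨hsub (hf N).src, hl.2, hl.1, (hf N).mem, fun _ => rfl⟩, hn⟩
    | succ j ih =>
      intro hj
      obtain ⟨n, hn⟩ := ih (by omega)
      have := hstep (N - (j + 1)) (hmin _ (by omega))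
      rw [show N - (j + 1) + 1 = N - j by omega] at this
      exact ⟨n + 1, _, this, hn⟩
  simpa [h0] using hback N le_rfl

/-- If the system player wins somewhere in `U`, then it wins somewhere while avoiding the
complement of some winning set. -/
theorem exists_sysWin_sdiff (hU : Total E U) {u : V} (hu : u ∈ U)
    (hw : SysWin E sys F U u) :
    ∃ Y A r, Y ⊆ U ∧ F Y ∧ IsAttractor E (fun u => ¬ sys u) U (U \ Y) A r ∧
      ∃ u ∈ U \ A, SysWin E sys F (U \ A) u := by
  by_contra hc
  push Not at hc
  obtain ⟨M, μ, c, m, hw⟩ := hw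
  obtain ⟨e, he⟩ := exists_surjective_nat (Finset V)
  obtain ⟨f, h0, hf, hP⟩ := exists_seq_of_reachIn (R := Step E sys U μ c)
    (I := fun s => s.1 ∈ U ∧ Wins E sys F U μ c s)
    (P := fun k s => e k.unpair.1 ⊆ U → F (e k.unpair.1) → s.1 ∉ e k.unpair.1)
    (fun s t hs ht => ⟨ht.tgt, hs.2.step ht⟩)
    (fun s hs => Step.exists hU μ c hs.1)
    (fun s hs k => by
      by_cases hY : e k.unpair.1 ⊆ U ∧ F (e k.unpair.1)
      · obtain ⟨A, r, hA⟩ := exists_isAttractor (E := E) (fun u => ¬ sys u)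
          (Finset.sdiff_subset : U \ e k.unpair.1 ⊆ U)
        simpa [hY.1, hY.2] using
          exists_reachIn_sdiff hU hA (hc _ A r hY.1 hY.2 hA) hs.1 hs.2
      · exact ⟨0, fun h1 h2 => absurd ⟨h1, h2⟩ hY⟩)
    (s₀ := (u, m)) ⟨hu, hw⟩
  have hwin := hw f h0 hf
  obtain ⟨i, hi⟩ := he (infSet fun n => (f n).1)
  have hsub : infSet (fun n => (f n).1) ⊆ U := infSet_subset fun n => (hf n).src
  have : ∃ᶠ n in atTop, (f n).1 ∉ infSet (fun n => (f n).1) := by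
    rw [frequently_atTop]
    intro N
    obtain ⟨n, hn, h⟩ := hP (Nat.pair i N)
    have := Nat.right_le_pair i N
    simp only [Nat.unpair_pair, hi] at h
    exact ⟨n, by omega, h hsub hwin⟩
  obtain ⟨v, hv, hv'⟩ := exists_mem_infSet (P := fun v => v ∉ infSet (fun n => (f n).1)) this
  exact hv' hv

theorem IsAttractor.sysWin_sdiff {T A : Finset V} {r : V → ℕ}
    (hA : IsAttractor E sys U T A r) (hU : Total E U) {u : V} (hw : SysWin E sys F U u) :
    SysWin E sys F (U \ A) u := by
  refine hw.of_trap hU Finset.sdiff_subset fun u hu hs w hw hE => ?_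
  rw [Finset.mem_sdiff] at hu ⊢
  exact ⟨hw, hA.own_trap u hu.1 hu.2 hs w hw hE⟩

theorem UniformWin.of_attractor (hU : Total E U) {W A : Finset V} {r : V → ℕ}
    (hA : IsAttractor E sys U W A r) (hWt : Total E W)
    (hWtrap : ∀ u ∈ W, ¬ sys u → ∀ w ∈ U, E u w → w ∈ W)
    (h1 : UniformWin E sys F W M) (h2 : UniformWin E sys F (U \ A) M) :
    UniformWin E sys F U M := by
  obtain ⟨μ₁, c₁, h1⟩ := h1
  obtain ⟨μ₂, c₂, h2⟩ := h2
  have hWU : W ⊆ U := hA.target_subset.trans hA.subset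
  have hU₂ := hA.total_sdiff hU
  refine ⟨fun m u => if u ∈ W then μ₁ m u else if u ∈ A then m else μ₂ m u,
    fun u m => if u ∈ W then legalize E W u (c₁ u m) else if u ∈ A then attractMove E A r u
      else legalize E (U \ A) u (c₂ u m), fun u hu m f h0 hf => ?_⟩
  by_cases hex : ∃ N, (f N).1 ∈ W
  · obtain ⟨N, hN⟩ := hex
    have hmv : ∀ n, (f n).1 ∈ W → sys (f n).1 →
        (f (n + 1)).1 = legalize E W (f n).1 (c₁ (f n).1 (f (n + 1)).2) := by
      intro n hn hs
      have := (hf n).move hs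
      have hl := legalize_spec hWt hn (c₁ (f n).1 (f (n + 1)).2)
      rwa [if_pos hn, legalize_of_legal hl.1 (hWU hl.2)] at this
    have hst : ∀ n ≥ N, (f n).1 ∈ W := by
      intro n hn
      induction n, hn using Nat.le_induction with
      | base => exact hN
      | succ n hn ih =>
        by_cases hs : sys (f n).1
        · rw [hmv n ih hs]
          exact (legalize_spec hWt ih _).2
        · exact hWtrap _ ih hs _ (hf n).tgt (hf n).edge
    refine UniformWin.of_tail h1 N fun n hn => ⟨hst n hn, hst _ (by omega), (hf n).edge, ?_,
      hmv n (hst n hn)⟩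
    rw [(hf n).mem, if_pos (hst n hn)]
  · push Not at hex
    have hnA := hA.not_mem_of_avoid (π := fun n => (f n).1) (N := 0) (fun n => (hf n).src)
      (fun n => (hf n).edge) (fun n _ hn hs => by
        have := (hf n).move hs
        have hl := hA.attractMove_spec hn (hex n) hs
        rwa [if_neg (hex n), if_pos hn, legalize_of_legal hl.2.1 (hA.subset hl.1)] at this)
      (fun n _ => hex n)
    have hmem : ∀ n, (f n).1 ∈ U \ A := fun n =>
      Finset.mem_sdiff.2 ⟨(hf n).src, hnA n (Nat.zero_le n)⟩
    refine UniformWin.of_tail h2 0 fun n _ => ⟨hmem n, hmem _, (hf n).edge, ?_, fun hs => ?_⟩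
    · rw [(hf n).mem, if_neg (hex n), if_neg (hnA n (Nat.zero_le n))]
    · have := (hf n).move hs
      have hl := legalize_spec hU₂ (hmem n) (c₂ (f n).1 (f (n + 1)).2)
      rwa [if_neg (hex n), if_neg (hnA n (Nat.zero_le n)),
        legalize_of_legal hl.1 (Finset.sdiff_subset hl.2)] at this

theorem frequently_of_cyclic {n : ℕ} {mode : ℕ → Fin (n + 1)} {sw : ℕ → Prop}
    (hstay : ∀ k, ¬ sw k → mode (k + 1) = mode k) (hswitch : ∀ k, sw k → mode (k + 1) = mode k + 1)
    (hinf : ∃ᶠ k in atTop, sw k) (i : Fin (n + 1)) : ∃ᶠ k in atTop, mode k = i ∧ sw k := by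
  have hnext : ∀ k, ∃ l ≥ k, mode l = mode k ∧ sw l := by
    intro k
    classical
    have hex : ∃ d, sw (k + d) := by
      obtain ⟨b, hb, h⟩ := (frequently_atTop.1 hinf) k
      exact ⟨b - k, by rwa [Nat.add_sub_cancel' hb]⟩
    have hmode : ∀ d ≤ Nat.find hex, mode (k + d) = mode k := by
      intro d
      induction d with
      | zero => intro _; rfl
      | succ d ih =>
        intro hd
        rw [← add_assoc, hstay _ (Nat.find_min hex (by omega)), ih (by omega)]
    exact ⟨k + Nat.find hex, by omega, hmode _ le_rfl, Nat.find_spec hex⟩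
  have hsucc : ∀ j, (∃ᶠ k in atTop, mode k = j ∧ sw k) →
      ∃ᶠ k in atTop, mode k = j + 1 ∧ sw k := by
    intro j h
    rw [frequently_atTop] at h ⊢
    intro a
    obtain ⟨b, hb, rfl, hs⟩ := h a
    obtain ⟨l, hl, h1, h2⟩ := hnext (b + 1)
    exact ⟨l, by omega, by rw [h1, hswitch b hs], h2⟩
  obtain ⟨j, hj⟩ : ∃ j, ∃ᶠ k in atTop, mode k = j ∧ sw k := by
    by_contra hc
    push Not at hc
    have := eventually_all.2 fun j => hc j
    exact hinf (this.mono fun k hk => hk (mode k) rfl)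
  have hadd : ∀ d : ℕ, ∃ᶠ k in atTop, mode k = j + Fin.ofNat (n + 1) d ∧ sw k := by
    intro d
    induction d with
    | zero => simpa using hj
    | succ d ih =>
      have : Fin.ofNat (n + 1) (d + 1) = Fin.ofNat (n + 1) d + 1 := by
        ext
        simp [Fin.val_add]
      rw [this, ← add_assoc]
      exact hsucc _ ih
  have := hadd (i - j).val
  rwa [Fin.ofNat_val_eq_self, add_sub_cancel] at this

theorem UniformWin.of_cyclic (hU : Total E U) {n : ℕ} {Y A : Fin (n + 1) → Finset V}
    {r : Fin (n + 1) → V → ℕ} {K : Fin (n + 1) → Type} [∀ i, Nonempty (K i)]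
    (hY : ∀ S ⊆ U, ¬ F S → ∃ i, S ⊆ Y i)
    (hA : ∀ i, IsAttractor E sys U (U \ Y i) (A i) (r i))
    (hwin : ∀ i, UniformWin E sys F (U \ A i) (K i)) :
    UniformWin E sys F U (Σ i, K i) := by
  choose μ c h using hwin
  have hUt := fun i => (hA i).total_sdiff hU
  refine ⟨fun m u => if u ∉ Y m.1 then ⟨m.1 + 1, Classical.arbitrary _⟩
      else if u ∈ A m.1 then m else ⟨m.1, μ m.1 m.2 u⟩,
    fun u m => if u ∈ A m.1 then attractMove E (A m.1) (r m.1) u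
      else legalize E (U \ A m.1) u (c m.1 u m.2), fun u hu m f h0 hf => ?_⟩
  by_cases hinf : ∃ᶠ k in atTop, (f k).1 ∉ Y (f k).2.1
  · by_contra hF
    obtain ⟨i, hi⟩ := hY _ (infSet_subset fun n => (hf n).src) hF
    have := frequently_of_cyclic (mode := fun k => (f k).2.1) (fun k hk => by
        rw [(hf k).mem, if_neg hk]
        split_ifs <;> rfl) (fun k hk => by rw [(hf k).mem, if_pos hk]) hinf i
    obtain ⟨v, hv, hv'⟩ := exists_mem_infSet (π := fun n => (f n).1) (P := fun v => v ∉ Y i)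
      (this.mono fun k hk => by rw [← hk.1]; exact hk.2)
    exact hv' (hi hv)
  · rw [not_frequently, eventually_atTop] at hinf
    obtain ⟨N, hN⟩ := hinf
    have hmode : ∀ k ≥ N, (f k).2.1 = (f N).2.1 := by
      intro k hk
      induction k, hk using Nat.le_induction with
      | base => rfl
      | succ k hk ih =>
        rw [← ih, (hf k).mem, if_neg (hN k hk)]
        split_ifs <;> rfl
    obtain ⟨i, hi⟩ : ∃ i, i = (f N).2.1 := ⟨_, rfl⟩
    rw [← hi] at hmode
    have hx : ∀ k, ∃ x : K i, k ≥ N → (f k).2 = ⟨i, x⟩ := by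
      intro k
      by_cases hk : k ≥ N
      · have := hmode k hk
        rcases hfk : (f k).2 with ⟨j, x⟩
        rw [hfk] at this
        subst this
        exact ⟨x, fun _ => rfl⟩
      · exact ⟨Classical.arbitrary _, fun h => absurd h hk⟩
    choose x hx using hx
    have hYi : ∀ k ≥ N, (f k).1 ∈ Y i := by
      intro k hk
      have := hN k hk
      rwa [not_not, hmode k hk] at this
    have hnA := (hA i).not_mem_of_avoid (π := fun n => (f n).1) (N := N) (fun n => (hf n).src)
      (fun n => (hf n).edge) (fun k hk hkA hs => by
        have := (hf k).move hs
        have hl := (hA i).attractMove_spec hkA (fun h => (Finset.mem_sdiff.1 h).2 (hYi k hk)) hs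
        rw [hx (k + 1) (by omega)] at this
        simp only at this hkA
        rwa [if_pos hkA, legalize_of_legal hl.2.1 ((hA i).subset hl.1)] at this)
      (fun k hk h => (Finset.mem_sdiff.1 h).2 (hYi k hk))
    have hmem : ∀ k ≥ N, (f k).1 ∈ U \ A i := fun k hk =>
      Finset.mem_sdiff.2 ⟨(hf k).src, hnA k hk⟩
    refine UniformWin.of_tail (f := fun k => ((f k).1, x k)) (h i) N fun k hk =>
      ⟨hmem k hk, hmem _ (by omega), (hf k).edge, ?_, fun hs => ?_⟩
    · have := (hf k).mem
      rw [hx k hk, hx (k + 1) (by omega)] at this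
      simp only at this
      rw [if_neg (not_not.2 (hYi k hk)), if_neg (hnA k hk)] at this
      simpa using this
    · have := (hf k).move hs
      have hl := legalize_spec (hUt i) (hmem k hk) (c i (f k).1 (x (k + 1)))
      rw [hx (k + 1) (by omega)] at this
      simp only at this
      rwa [if_neg (hnA k hk), legalize_of_legal hl.1 (Finset.sdiff_subset hl.2)] at this

/-- `Y` is a maximal losing subset of `U`. -/
def IsMaxLosing (F : Finset V → Prop) (U Y : Finset V) : Prop :=
  Maximal (fun S => S ⊆ U ∧ ¬ F S) Y

open Classical in
/-- Upper bound on the memory needed in Muller games, for any measure `N` that is superadditive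
over the maximal losing subsets of winning sets. -/
theorem uniformWin_of_sysWin {N : Finset V → ℕ} (hpos : ∀ S, 0 < N S) (hmono : Monotone N)
    (hsum : ∀ U, F U → ∑ Y with IsMaxLosing F U Y, N Y ≤ N U) (U : Finset V) (hU : Total E U)
    (hw : ∀ u ∈ U, SysWin E sys F U u) : UniformWin E sys F U (Fin (N U)) := by
  induction U using Finset.strongInduction with
  | H U ih =>
  have hne : ∀ S, Nonempty (Fin (N S)) := fun S => ⟨⟨0, hpos S⟩⟩
  rcases U.eq_empty_or_nonempty with rfl | ⟨u₀, hu₀⟩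
  · exact ⟨fun m _ => m, fun u _ => u, by simp⟩
  by_cases hF : F U
  · obtain ⟨n, e⟩ : ∃ n, Nonempty ({Y // IsMaxLosing F U Y} ≃ Fin n) :=
      ⟨_, ⟨Fintype.equivFin _⟩⟩
    obtain ⟨e⟩ := e
    have hmax : ∀ S ⊆ U, ¬ F S → ∃ Y, IsMaxLosing F U Y ∧ S ⊆ Y := by
      intro S hS hFS
      obtain ⟨Y, hSY, hY⟩ := (Set.toFinite {S | S ⊆ U ∧ ¬ F S}).exists_le_maximal ⟨hS, hFS⟩
      exact ⟨Y, hY, hSY⟩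
    cases n with
    | zero =>
      refine ⟨fun m _ => m, fun u _ => u, fun u hu m f h0 hf => ?_⟩
      by_contra hc
      obtain ⟨Y, hY, -⟩ := hmax _ (infSet_subset fun n => (hf n).src) hc
      exact (e ⟨Y, hY⟩).elim0
    | succ n =>
      have hYU : ∀ i, (e.symm i).1 ⊆ U := fun i => (e.symm i).2.prop.1
      have hattr := fun i => exists_isAttractor (E := E) sys
        (Finset.sdiff_subset : U \ (e.symm i).1 ⊆ U)
      choose A r hA using hattr
      have hAY : ∀ i, U \ A i ⊆ (e.symm i).1 := by
        intro i v hv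
        rw [Finset.mem_sdiff] at hv
        by_contra hc
        exact hv.2 ((hA i).target_subset (Finset.mem_sdiff.2 ⟨hv.1, hc⟩))
      have hlt : ∀ i, U \ A i ⊂ U := by
        intro i
        refine Finset.ssubset_of_subset_of_ssubset (hAY i) ((hYU i).ssubset_of_ne ?_)
        intro h
        exact (e.symm i).2.prop.2 (by rwa [h])
      have hcyc := UniformWin.of_cyclic hU (fun S hS hFS => by
          obtain ⟨Y, hY, hSY⟩ := hmax S hS hFS
          exact ⟨e ⟨Y, hY⟩, by simpa using hSY⟩) hA
        (K := fun i => Fin (N (U \ A i))) fun i =>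
          ih _ (hlt i) ((hA i).total_sdiff hU) fun u hu =>
            (hA i).sysWin_sdiff hU (hw u (Finset.sdiff_subset hu))
      have : Nonempty (Σ i, Fin (N (U \ A i))) := ⟨⟨0, 0, hpos _⟩⟩
      refine hcyc.transfer ?_
      calc Fintype.card (Σ i, Fin (N (U \ A i))) = ∑ i, N (U \ A i) := by simp
        _ ≤ ∑ i, N (e.symm i).1 := Finset.sum_le_sum fun i _ => hmono (hAY i)
        _ = ∑ Y : {Y // IsMaxLosing F U Y}, N Y.1 := e.symm.sum_comp fun Y => N Y.1
        _ = ∑ Y with IsMaxLosing F U Y, N Y :=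
          (Finset.sum_subtype _ (by simp) N).symm
        _ ≤ N U := hsum U hF
        _ = Fintype.card (Fin (N U)) := by simp
  · obtain ⟨Y, B, rB, hYU, hFY, hB, u, hu, huw⟩ := exists_sysWin_sdiff hU hu₀ (hw u₀ hu₀)
    set W := winRegion E sys F (U \ B) with hW
    have hUB := hB.total_sdiff hU
    have hWU : W ⊆ U := winRegion_subset.trans Finset.sdiff_subset
    obtain ⟨A, r, hA⟩ := exists_isAttractor (E := E) sys hWU
    have huW : u ∈ W := mem_winRegion.2 ⟨hu, huw⟩
    have hWlt : W ⊂ U := by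
      refine hWU.ssubset_of_ne fun h => hF ?_
      have : Y = U := by
        refine hYU.antisymm fun v hv => ?_
        by_contra hc
        have h1 : v ∈ U \ B := winRegion_subset (hW ▸ h ▸ hv)
        exact (Finset.mem_sdiff.1 h1).2 (hB.target_subset (Finset.mem_sdiff.2 ⟨hv, hc⟩))
      exact this ▸ hFY
    have hAlt : U \ A ⊂ U := by
      refine Finset.sdiff_subset.ssubset_of_ne fun h => ?_
      have : u ∈ U \ A := h.symm ▸ hWU huW
      exact (Finset.mem_sdiff.1 this).2 (hA.target_subset huW)
    have h1 := (ih W hWlt (total_winRegion hUB) fun u hu => sysWin_winRegion hUB hu).transfer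
      (M' := Fin (N U)) (by simpa using hmono hWU)
    have h2 := (ih _ hAlt (hA.total_sdiff hU) fun u hu =>
      hA.sysWin_sdiff hU (hw u (Finset.sdiff_subset hu))).transfer
      (M' := Fin (N U)) (by simpa using hmono Finset.sdiff_subset)
    refine .of_attractor hU hA (total_winRegion hUB) (fun u hu hs w hwU hE => ?_) h1 h2
    have huB := Finset.mem_sdiff.1 (winRegion_subset hu)
    exact winRegion_trap hu hs
      (Finset.mem_sdiff.2 ⟨hwU, hB.own_trap u huB.1 huB.2 hs w hwU hE⟩) hE

end Memory

end MullerGame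

open scoped Nat in
/-- A weak form of the Lubell–Yamamoto–Meshalkin inequality. -/
theorem IsAntichain.sum_card_factorial_le {α : Type*} [DecidableEq α] (G : Finset α)
    {𝒜 : Finset (Finset α)} (h𝒜 : IsAntichain (· ⊆ ·) (𝒜 : Set (Finset α)))
    (hG : ∀ s ∈ 𝒜, s ⊆ G) : ∑ s ∈ 𝒜, (s.card)! ≤ (G.card)! := by
  induction G using Finset.strongInduction generalizing 𝒜 with
  | H G ih =>
  by_cases hmem : G ∈ 𝒜
  · have : 𝒜 = {G} := by
      refine Finset.eq_singleton_iff_unique_mem.2 ⟨hmem, fun s hs => ?_⟩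
      by_contra hne
      exact h𝒜 hs hmem hne (hG s hs)
    simp [this]
  rcases G.eq_empty_or_nonempty with rfl | hne
  · have : 𝒜 = ∅ := by
      refine Finset.eq_empty_of_forall_notMem fun s hs => hmem ?_
      rwa [← Finset.subset_empty.1 (hG s hs)]
    simp [this]
  calc ∑ s ∈ 𝒜, (s.card)!
      ≤ ∑ s ∈ 𝒜, ∑ a ∈ G, if s ⊆ G.erase a then (s.card)! else 0 := by
        refine Finset.sum_le_sum fun s hs => ?_
        obtain ⟨a, ha, has⟩ := Finset.exists_of_ssubset
          ((hG s hs).ssubset_of_ne fun h => hmem (h ▸ hs))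
        refine le_trans ?_ (Finset.single_le_sum (fun _ _ => Nat.zero_le _) ha)
        rw [if_pos (Finset.subset_erase.2 ⟨hG s hs, has⟩)]
    _ = ∑ a ∈ G, ∑ s ∈ 𝒜 with s ⊆ G.erase a, (s.card)! := by
        rw [Finset.sum_comm]
        simp only [Finset.sum_filter]
    _ ≤ ∑ a ∈ G, (G.card - 1)! := by
        refine Finset.sum_le_sum fun a ha => ?_
        rw [← Finset.card_erase_of_mem ha]
        exact ih _ (Finset.erase_ssubset ha) (h𝒜.subset fun s hs => (Finset.mem_filter.1 hs).1)
          (by simp)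
    _ = (G.card)! := by
        rw [Finset.sum_const, smul_eq_mul, Nat.mul_factorial_pred (Finset.card_ne_zero.2 hne)]

namespace ELForm

open Filter MullerGame

variable {V Γ : Type}

/-- Satisfaction of an Emerson-Lei formula by the set of nodes visited infinitely often. -/
def satSet (γ : V → Finset Γ) (S : Finset V) : ELForm Γ → Prop
  | .tt => True
  | .ff => False
  | .gf a => ∃ v ∈ S, a ∈ γ v
  | .fg a => ∀ v ∈ S, a ∈ γ v
  | .and φ ψ => φ.satSet γ S ∧ ψ.satSet γ S
  | .or φ ψ => φ.satSet γ S ∨ ψ.satSet γ S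

theorem sat_iff_satSet [Fintype V] (γ : V → Finset Γ) (π : ℕ → V) (φ : ELForm Γ) :
    φ.sat (fun n => γ (π n)) ↔ φ.satSet γ (infSet π) := by
  induction φ with
  | tt => exact Iff.rfl
  | ff => exact Iff.rfl
  | gf a =>
    have : (∀ i, ∃ j > i, a ∈ γ (π j)) ↔ ∃ᶠ n in atTop, a ∈ γ (π n) := frequently_atTop'.symm
    refine this.trans ⟨fun h => exists_mem_infSet (P := fun v => a ∈ γ v) h, ?_⟩
    rintro ⟨v, hv, ha⟩
    exact (mem_infSet.1 hv).mono fun n hn => hn ▸ ha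
  | fg a =>
    have : (∃ i, ∀ j > i, a ∈ γ (π j)) ↔ ∀ᶠ n in atTop, a ∈ γ (π n) := by
      rw [← not_iff_not, not_eventually, frequently_atTop']
      push Not
      rfl
    refine this.trans ⟨fun h v hv => ?_, fun h => ?_⟩
    · obtain ⟨n, rfl, hn⟩ := ((mem_infSet.1 hv).and_eventually h).exists
      exact hn
    · by_contra hc
      obtain ⟨v, hv, hv'⟩ := exists_mem_infSet (P := fun v => a ∉ γ v) (not_eventually.1 hc)
      exact hv' (h v hv)
  | and φ ψ h1 h2 => exact and_congr h1 h2
  | or φ ψ h1 h2 => exact or_congr h1 h2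

theorem satSet_anti [DecidableEq Γ] {γ : V → Finset Γ} {S T : Finset V} (hST : S ⊆ T)
    (hγ : T.biUnion γ ⊆ S.biUnion γ) {φ : ELForm Γ} (h : φ.satSet γ T) : φ.satSet γ S := by
  induction φ with
  | tt => trivial
  | ff => exact h
  | gf a => simpa [satSet] using @hγ a (by simpa [satSet] using h)
  | fg a => exact fun v hv => h v (hST hv)
  | and φ ψ h1 h2 => exact ⟨h1 h.1, h2 h.2⟩
  | or φ ψ h1 h2 => exact h.imp h1 h2

theorem eq_of_isMaxLosing [DecidableEq Γ] [Fintype V] [DecidableEq V] {γ : V → Finset Γ}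
    {φ : ELForm Γ} {U Y Z : Finset V} (hY : IsMaxLosing (fun S => φ.satSet γ S) U Y)
    (hZ : IsMaxLosing (fun S => φ.satSet γ S) U Z) (hYZ : Y.biUnion γ ⊆ Z.biUnion γ) : Y = Z := by
  have hsub : ∀ S ⊆ U, S.biUnion γ ⊆ Z.biUnion γ →
      S ⊆ U.filter fun v => γ v ⊆ Z.biUnion γ := fun S hS hSZ v hv =>
    Finset.mem_filter.2 ⟨hS hv, (Finset.subset_biUnion_of_mem γ hv).trans hSZ⟩
  have hZ' := hsub Z hZ.prop.1 subset_rfl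
  have hle := hZ.le_of_ge (y := U.filter fun v => γ v ⊆ Z.biUnion γ)
    ⟨Finset.filter_subset _ _, fun h => hZ.prop.2 (satSet_anti hZ'
      (Finset.biUnion_subset.2 fun v hv => (Finset.mem_filter.1 hv).2) h)⟩ hZ'
  exact hY.eq_of_le hZ.prop ((hsub Y hY.prop.1 hYZ).trans hle)

open Classical in
theorem sum_isMaxLosing_le [Fintype V] (γ : V → Finset Γ) (φ : ELForm Γ) (U : Finset V) :
    ∑ Y with IsMaxLosing (fun S => φ.satSet γ S) U Y, (Y.biUnion γ).card.factorial ≤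
      (U.biUnion γ).card.factorial := by
  have hinj : Set.InjOn (fun Y : Finset V => Y.biUnion γ)
      (Finset.univ.filter fun Y => IsMaxLosing (fun S => φ.satSet γ S) U Y : Finset (Finset V)) := by
    intro Y hY Z hZ h
    simp only [Finset.coe_filter, Finset.mem_univ, true_and, Set.mem_ofPred_eq] at hY hZ
    exact eq_of_isMaxLosing hY hZ h.le
  rw [← Finset.sum_image (f := fun s : Finset Γ => s.card.factorial) hinj]
  refine IsAntichain.sum_card_factorial_le _ ?_ ?_
  · intro s hs t ht hne hst
    simp only [Finset.coe_image, Finset.coe_filter, Finset.mem_univ, true_and, Set.mem_image,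
      Set.mem_ofPred_eq] at hs ht
    obtain ⟨Y, hY, rfl⟩ := hs
    obtain ⟨Z, hZ, rfl⟩ := ht
    exact hne (by rw [eq_of_isMaxLosing hY hZ hst])
  · intro s hs
    simp only [Finset.mem_image, Finset.mem_filter, Finset.mem_univ, true_and] at hs
    obtain ⟨Y, hY, rfl⟩ := hs
    exact Finset.biUnion_subset_biUnion_of_subset_left γ hY.prop.1

end ELForm

open MullerGame in
theorem Arena.SysWins.sysWin_univ {V : Type} [Fintype V] {A : Arena V} {F : Finset V → Prop}
    {v : V} (h : A.SysWins (fun π => F (infSet π)) v) :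
    SysWin A.E A.sys F Finset.univ v := by
  obtain ⟨σ, hσ, h⟩ := h
  refine ⟨List V, fun h u => h ++ [u], fun u m => σ m.dropLast u, [], fun f h0 hf => ?_⟩
  have hist : ∀ n, (f n).2 = (List.range n).map fun n => (f n).1 := by
    intro n
    induction n with
    | zero => simp [h0]
    | succ n ih => rw [(hf n).mem, ih]; simp [List.range_succ]
  refine h (fun n => (f n).1) (fun n => (hf n).edge) (by simp [h0]) fun n hs => ?_
  have := (hf n).move hs
  rw [(hf n).mem, List.dropLast_concat, hist n,
    legalize_of_legal (hσ _ _ hs) (Finset.mem_univ _)] at this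
  exact this

/-- in every Emerson-Lei game with `k` events, if the system
player has a winning strategy from a node `v`, then it has a finite-memory
winning strategy from `v` using at most `k!` memory values. -/
theorem el_finite_memory_strategies
    {V Γ : Type} [Fintype V] [Fintype Γ]
    (A : Arena V) (γ : V → Finset Γ) (φ : ELForm Γ) (v : V)
    (hwin : A.SysWins (fun π => φ.sat (fun n => γ (π n))) v) :
    ∃ (M : Type) (instM : Fintype M) (m₀ : M) (μ : M → V → M) (c : V → M → V),
      @Fintype.card M instM ≤ Nat.factorial (Fintype.card Γ) ∧
      (∀ (u : V) (m : M), A.sys u → A.E u (c u m)) ∧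
      A.ValidSysStrat (inducedStrategy m₀ μ c) ∧
      ∀ π : ℕ → V, A.IsPlay π → π 0 = v →
        A.SysCompatible (inducedStrategy m₀ μ c) π →
        φ.sat (fun n => γ (π n)) := by
  classical
  let F : Finset V → Prop := fun S => φ.satSet γ S
  have hsat : ∀ π : ℕ → V, φ.sat (fun n => γ (π n)) ↔ F (MullerGame.infSet π) := fun π =>
    φ.sat_iff_satSet γ π
  simp only [hsat] at hwin ⊢
  let N : Finset V → ℕ := fun S => (S.biUnion γ).card.factorial
  have hUt : MullerGame.Total A.E (Finset.univ : Finset V) := fun u _ =>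
    (A.succ_nonempty u).imp fun w hw => ⟨hw, Finset.mem_univ w⟩
  set W := MullerGame.winRegion A.E A.sys F Finset.univ
  have hWt : MullerGame.Total A.E W := MullerGame.total_winRegion hUt
  have hv : v ∈ W := MullerGame.mem_winRegion.2 ⟨Finset.mem_univ v, hwin.sysWin_univ⟩
  obtain ⟨μ, c, h⟩ := MullerGame.uniformWin_of_sysWin (N := N)
    (fun S => Nat.factorial_pos _)
    (fun S T h => Nat.factorial_le
      (Finset.card_le_card (Finset.biUnion_subset_biUnion_of_subset_left γ h)))
    (fun U _ => φ.sum_isMaxLosing_le γ U) W hWt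
    (fun u hu => MullerGame.sysWin_winRegion hUt hu)
  choose next hnext using A.succ_nonempty
  let c' : V → Fin (N W) → V := fun u m =>
    if u ∈ W then MullerGame.legalize A.E W u (c u m) else next u
  have hc' : ∀ u m, A.E u (c' u m) := by
    intro u m
    by_cases hu : u ∈ W
    · simp only [c', if_pos hu]
      exact (MullerGame.legalize_spec hWt hu _).1
    · simp only [c', if_neg hu]
      exact hnext u
  refine ⟨Fin (N W), inferInstance, ⟨0, Nat.factorial_pos _⟩, μ, c', ?_, fun u m _ => hc' u m,
    fun _ u _ => hc' u _, fun π hπ h0 hcomp => ?_⟩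
  · rw [Fintype.card_fin]
    exact Nat.factorial_le (Finset.card_le_univ _)
  · set m₀ : Fin (N W) := ⟨0, Nat.factorial_pos _⟩
    let mem : ℕ → Fin (N W) := fun n => List.foldl μ m₀ ((List.range n).map π)
    have hmem : ∀ n, mem (n + 1) = μ (mem n) (π n) := by
      intro n
      simp [mem, List.range_succ]
    have hmove : ∀ n, π n ∈ W → A.sys (π n) →
        π (n + 1) = MullerGame.legalize A.E W (π n) (c (π n) (mem (n + 1))) := by
      intro n hn hs
      rw [hcomp n hs]
      simp [inducedStrategy, c', hn, hmem, mem]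
    have hW : ∀ n, π n ∈ W := by
      intro n
      induction n with
      | zero => rwa [h0]
      | succ n ih =>
        by_cases hs : A.sys (π n)
        · rw [hmove n ih hs]
          exact (MullerGame.legalize_spec hWt ih _).2
        · exact MullerGame.winRegion_trap ih hs (Finset.mem_univ _) (hπ n)
    exact h v hv m₀ (fun n => (π n, mem n)) (by simp [h0, mem])
      fun n => ⟨hW n, hW _, hπ n, hmem n, hmove n (hW n)⟩
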